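/- Assume c ∈ O_K with v(c^p − c) ≥ 1 and v(c) < p/((q+1)(p−1)). Then any two distinct roots y ≠ y′ of L_c(X) in Ω satisfy v(y^{q²/p} − y′^{q²/p}) = (q²/p)·v(y − y′) = q²/((q+1)(p−1)), where q²/p = p^{2n−1}. -/

import Mathlib

open Polynomial

noncomputable section

/-- `K₀`: the fraction field of the Witt vectors over `𝔽̄_p`, i.e. the completion of `ℚ_p^ur`. -/
abbrev Kzero (p : ℕ) [Fact p.Prime] : Type :=
  FractionRing (WittVector p (AlgebraicClosure (ZMod p)))

/-- `Ω`: a fixed algebraic closure of `K₀`. -/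
abbrev Omg (p : ℕ) [Fact p.Prime] : Type := AlgebraicClosure (Kzero p)

/-- `a_n = (-1)^q · (-p)^(p + p² + ⋯ + pⁿ)` as an element of a commutative ring. -/
def aCoef (R : Type) [CommRing R] (p n : ℕ) : R :=
  (-1) ^ p ^ n * (-(p : R)) ^ (Finset.sum (Finset.range n) fun i => p ^ (i + 1))

/-- `f_{q,c}(X) = 1 + c·X^q + X^(1+q)` with `q = pⁿ`. -/
def fqc (R : Type) [CommRing R] (p n : ℕ) (c : R) : Polynomial R :=
  1 + C c * X ^ p ^ n + X ^ (p ^ n + 1)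

/-- The modified monodromy polynomial `L_c(X) = X^(q²) − a_n·(c+X)·f_{q,c}(X)^(q−1)`. -/
def Lpoly (R : Type) [CommRing R] (p n : ℕ) (c : R) : Polynomial R :=
  X ^ (p ^ n * p ^ n) - C (aCoef R p n) * (C c + X) * fqc R p n c ^ (p ^ n - 1)

section LowerBounds

variable {F : Type*} [Field F]

/-- `v` satisfies the axioms of an additive rational valuation away from `0`
(its value at `0` is arbitrary). -/
structure IsRatValuation (v : F → ℚ) : Prop where
  mul : ∀ x y : F, x ≠ 0 → y ≠ 0 → v (x * y) = v x + v y
  add : ∀ x y : F, x ≠ 0 → y ≠ 0 → x + y ≠ 0 → min (v x) (v y) ≤ v (x + y)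

/-- `x` has valuation at least `r`, where `0` has valuation `+∞`. -/
def ValGe (v : F → ℚ) (r : ℚ) (x : F) : Prop := x = 0 ∨ r ≤ v x

variable {v : F → ℚ}

theorem ValGe.mono {r s : ℚ} {x : F} (hx : ValGe v r x) (hs : s ≤ r) : ValGe v s x :=
  hx.imp_right hs.trans

theorem ValGe.le {r : ℚ} {x : F} (hx : ValGe v r x) (h0 : x ≠ 0) : r ≤ v x :=
  hx.resolve_left h0

theorem ValGe.self (x : F) : ValGe v (v x) x := Or.inr le_rfl

theorem ValGe.zero (r : ℚ) : ValGe v r 0 := Or.inl rfl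

namespace IsRatValuation

theorem map_one (hv : IsRatValuation v) : v 1 = 0 := by
  have := hv.mul 1 1 one_ne_zero one_ne_zero
  rw [mul_one] at this
  linarith

theorem map_neg_one (hv : IsRatValuation v) : v (-1) = 0 := by
  have := hv.mul (-1) (-1) (by simp) (by simp)
  rw [neg_one_mul, neg_neg, hv.map_one] at this
  linarith

theorem map_neg (hv : IsRatValuation v) {x : F} (hx : x ≠ 0) : v (-x) = v x := by
  rw [← neg_one_mul, hv.mul _ _ (by simp) hx, hv.map_neg_one, zero_add]

theorem map_pow (hv : IsRatValuation v) {x : F} (hx : x ≠ 0) (k : ℕ) :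
    v (x ^ k) = k * v x := by
  induction k with
  | zero => simp [hv.map_one]
  | succ k ih =>
    rw [pow_succ, hv.mul _ _ (pow_ne_zero k hx) hx, ih]
    push_cast
    ring

theorem ge_one (hv : IsRatValuation v) : ValGe v 0 1 := Or.inr hv.map_one.ge

theorem ge_mul (hv : IsRatValuation v) {r s : ℚ} {x y : F} (hx : ValGe v r x)
    (hy : ValGe v s y) : ValGe v (r + s) (x * y) := by
  rcases eq_or_ne x 0 with rfl | hx0
  · simp [ValGe]
  rcases eq_or_ne y 0 with rfl | hy0
  · simp [ValGe]
  right
  rw [hv.mul _ _ hx0 hy0]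
  exact add_le_add (hx.le hx0) (hy.le hy0)

theorem ge_neg (hv : IsRatValuation v) {r : ℚ} {x : F} (hx : ValGe v r x) :
    ValGe v r (-x) := by
  rcases eq_or_ne x 0 with rfl | hx0
  · simp [ValGe]
  right
  rw [hv.map_neg hx0]
  exact hx.le hx0

theorem ge_add (hv : IsRatValuation v) {r : ℚ} {x y : F} (hx : ValGe v r x)
    (hy : ValGe v r y) : ValGe v r (x + y) := by
  rcases eq_or_ne x 0 with rfl | hx0
  · simpa using hy
  rcases eq_or_ne y 0 with rfl | hy0
  · simpa using hx
  by_cases h0 : x + y = 0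
  · exact Or.inl h0
  · exact Or.inr ((le_min (hx.le hx0) (hy.le hy0)).trans (hv.add x y hx0 hy0 h0))

theorem ge_sub (hv : IsRatValuation v) {r : ℚ} {x y : F} (hx : ValGe v r x)
    (hy : ValGe v r y) : ValGe v r (x - y) := by
  rw [sub_eq_add_neg]
  exact hv.ge_add hx (hv.ge_neg hy)

theorem ge_sum (hv : IsRatValuation v) {ι : Type*} {r : ℚ} {f : ι → F} (s : Finset ι)
    (h : ∀ i ∈ s, ValGe v r (f i)) : ValGe v r (∑ i ∈ s, f i) :=
  Finset.sum_induction f (ValGe v r) (fun _ _ => hv.ge_add) (ValGe.zero r) h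

theorem ge_pow (hv : IsRatValuation v) {r : ℚ} {x : F} (hx : ValGe v r x) (k : ℕ) :
    ValGe v (k * r) (x ^ k) := by
  induction k with
  | zero => simpa using hv.ge_one
  | succ k ih =>
    rw [pow_succ]
    exact (hv.ge_mul ih hx).mono (by push_cast; linarith)

theorem ge_natCast (hv : IsRatValuation v) (k : ℕ) : ValGe v 0 (k : F) := by
  induction k with
  | zero => simpa using ValGe.zero 0
  | succ k ih =>
    rw [Nat.cast_succ]
    exact hv.ge_add ih hv.ge_one

/-- A summand of strictly larger valuation does not change the valuation. -/
theorem add_eq_of_lt (hv : IsRatValuation v) {s : ℚ} {x y : F} (hx : x ≠ 0)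
    (hy : ValGe v s y) (hs : v x < s) : x + y ≠ 0 ∧ v (x + y) = v x := by
  have key : ∀ r, v x < r → ¬ ValGe v r x := fun r hr h => (h.le hx).not_gt hr
  have h0 : x + y ≠ 0 := by
    intro h
    refine key s hs ?_
    rw [eq_neg_of_add_eq_zero_left h]
    exact hv.ge_neg hy
  refine ⟨h0, le_antisymm ?_ ?_⟩
  · by_contra! hlt
    refine key (min s (v (x + y))) (lt_min hs hlt) ?_
    have := hv.ge_sub ((ValGe.self (v := v) (x + y)).mono (min_le_right s _))
      (hy.mono (min_le_left s _))
    simpa using this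
  · exact (hv.ge_add (ValGe.self x) (hy.mono hs.le)).le h0

/-- Differences of `k`-th powers are divisible by the difference of the bases, with a cofactor
of valuation at least `(k - 1) δ` when the bases have valuation at least `δ`. -/
theorem ge_pow_sub_pow (hv : IsRatValuation v) {δ : ℚ} {x y : F}
    (hx : ValGe v δ x) (hy : ValGe v δ y) (k : ℕ) :
    ValGe v (v (x - y) + (k - 1 : ℚ) * δ) (x ^ k - y ^ k) := by
  rw [← (Commute.all x y).mul_geom_sum₂]
  refine hv.ge_mul (ValGe.self _) (hv.ge_sum _ fun i hi => ?_)
  refine (hv.ge_mul (hv.ge_pow hx i) (hv.ge_pow hy (k - 1 - i))).mono ?_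
  rw [Finset.mem_range] at hi
  have h : ((k - 1 - i : ℕ) : ℚ) = k - 1 - i := by
    rw [Nat.sub_sub, Nat.cast_sub (by omega)]
    push_cast
    ring
  rw [h]
  apply le_of_eq
  ring

/-- In a binomial expansion with exponent a power of `p`, the mixed terms carry a factor `p`. -/
theorem ge_add_pow_prime_pow (hv : IsRatValuation v) {p : ℕ} (hp : p.Prime)
    (hvp : v (p : F) = 1) {x y : F} {r s b : ℚ} (hx : ValGe v r x) (hy : ValGe v s y) (m : ℕ)
    (hb : ∀ k ∈ Finset.Ioo 0 (p ^ m), b ≤ 1 + k * r + ((p ^ m : ℕ) - k : ℚ) * s) :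
    ValGe v b ((x + y) ^ p ^ m - x ^ p ^ m - y ^ p ^ m) := by
  have e : (x + y) ^ p ^ m - x ^ p ^ m - y ^ p ^ m =
      p * ∑ k ∈ Finset.Ioo 0 (p ^ m), x ^ k * y ^ (p ^ m - k) * ((p ^ m).choose k / p : ℕ) := by
    rw [add_pow_prime_pow_eq' hp]
    ring
  rw [e, Finset.mul_sum]
  refine hv.ge_sum _ fun k hk => ?_
  have hk' := Finset.mem_Ioo.mp hk
  refine (hv.ge_mul (ValGe.self (p : F)) (hv.ge_mul (hv.ge_mul (hv.ge_pow hx k)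
    (hv.ge_pow hy (p ^ m - k))) (hv.ge_natCast _))).mono ((hb k hk).trans_eq ?_)
  rw [hvp, Nat.cast_sub hk'.2.le]
  ring

end IsRatValuation

end LowerBounds

section MonodromyRoots

variable {F : Type} [Field F] {v : F → ℚ}

theorem IsRatValuation.root_ge (hv : IsRatValuation v) {q : ℕ} (hq : 1 ≤ q) {a c y : F}
    (ha : 0 < v a) (hc : ValGe v 0 c)
    (hy : y ^ (q * q) = a * (c + y) * (1 + c * y ^ q + y ^ (q + 1)) ^ (q - 1)) :
    ValGe v (v a / (q * q)) y := by
  have hq0 : (1 : ℚ) ≤ q := by exact_mod_cast hq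
  have hq1 : ((q - 1 : ℕ) : ℚ) = q - 1 := by push_cast [hq]; ring
  rcases eq_or_ne y 0 with rfl | hy0
  · exact ValGe.zero _
  have hpow : v (y ^ (q * q)) = q * q * v y := by
    rw [hv.map_pow hy0]
    push_cast
    ring
  have bound : ∀ r, r ≤ 0 → ValGe v r y →
      v a + r + ((q : ℚ) - 1) * ((q + 1) * r) ≤ q * q * v y := by
    intro r hr hyr
    have h1 : ValGe v ((q + 1 : ℚ) * r) (1 + c * y ^ q + y ^ (q + 1)) := by
      refine hv.ge_add (hv.ge_add (hv.ge_one.mono ?_)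
        ((hv.ge_mul hc (hv.ge_pow hyr q)).mono ?_)) ((hv.ge_pow hyr (q + 1)).mono ?_)
      · nlinarith
      · nlinarith
      · push_cast
        exact le_rfl
    have h2 := hv.ge_mul (hv.ge_mul (ValGe.self a) (hv.ge_add (hc.mono hr) hyr))
      (hv.ge_pow h1 (q - 1))
    rw [← hy, hq1] at h2
    exact hpow ▸ h2.le (pow_ne_zero _ hy0)
  have hpos : 0 ≤ v y := by
    by_contra! hneg
    have := bound (v y) hneg.le (ValGe.self y)
    nlinarith
  right
  rw [div_le_iff₀ (by positivity)]
  have := bound 0 le_rfl (Or.inr hpos)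
  linarith

/-- The map `x ↦ (c + x) f(x)^(q-1)` preserves distances on the maximal ideal. -/
theorem IsRatValuation.map_cofactor_sub (hv : IsRatValuation v) {q : ℕ} (hq : 2 ≤ q) {c x y : F}
    {δ : ℚ} (hδ : 0 < δ) (hc : ValGe v 0 c) (hx : ValGe v δ x) (hy : ValGe v δ y)
    (hxy : x - y ≠ 0) :
    (c + x) * (1 + c * x ^ q + x ^ (q + 1)) ^ (q - 1) -
        (c + y) * (1 + c * y ^ q + y ^ (q + 1)) ^ (q - 1) ≠ 0 ∧
      v ((c + x) * (1 + c * x ^ q + x ^ (q + 1)) ^ (q - 1) -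
        (c + y) * (1 + c * y ^ q + y ^ (q + 1)) ^ (q - 1)) = v (x - y) := by
  have hq2 : (2 : ℚ) ≤ q := by exact_mod_cast hq
  have hf : ∀ t, ValGe v δ t →
      1 + c * t ^ q + t ^ (q + 1) ≠ 0 ∧ v (1 + c * t ^ q + t ^ (q + 1)) = 0 := by
    intro t ht
    have h : ValGe v δ (c * t ^ q + t ^ (q + 1)) := by
      refine hv.ge_add ((hv.ge_mul hc (hv.ge_pow ht q)).mono ?_) ((hv.ge_pow ht (q + 1)).mono ?_)
      · nlinarith
      · push_cast
        nlinarith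
    have := hv.add_eq_of_lt one_ne_zero h (by rw [hv.map_one]; exact hδ)
    rwa [hv.map_one, ← add_assoc] at this
  obtain ⟨hfx0, hfx⟩ := hf x hx
  obtain ⟨hfy0, hfy⟩ := hf y hy
  have hdiff : ValGe v (v (x - y) + δ)
      ((1 + c * x ^ q + x ^ (q + 1)) - (1 + c * y ^ q + y ^ (q + 1))) := by
    have e : (1 + c * x ^ q + x ^ (q + 1)) - (1 + c * y ^ q + y ^ (q + 1)) =
        c * (x ^ q - y ^ q) + (x ^ (q + 1) - y ^ (q + 1)) := by ring
    rw [e]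
    refine hv.ge_add ((hv.ge_mul hc (hv.ge_pow_sub_pow hx hy q)).mono ?_)
      ((hv.ge_pow_sub_pow hx hy (q + 1)).mono ?_)
    · nlinarith
    · push_cast
      nlinarith
  generalize 1 + c * x ^ q + x ^ (q + 1) = f at *
  generalize 1 + c * y ^ q + y ^ (q + 1) = g at *
  have hfg : ValGe v (v (x - y) + δ) (f ^ (q - 1) - g ^ (q - 1)) := by
    rcases eq_or_ne (f - g) 0 with h | h
    · rw [sub_eq_zero.mp h, sub_self]
      exact ValGe.zero _
    · refine (hv.ge_pow_sub_pow (Or.inr hfx.ge) (Or.inr hfy.ge) (q - 1)).mono ?_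
      rw [mul_zero, add_zero]
      exact hdiff.le h
  have e : (c + x) * f ^ (q - 1) - (c + y) * g ^ (q - 1) =
      (x - y) * f ^ (q - 1) + (c + y) * (f ^ (q - 1) - g ^ (q - 1)) := by ring
  have hmain0 : (x - y) * f ^ (q - 1) ≠ 0 := mul_ne_zero hxy (pow_ne_zero _ hfx0)
  have hmain : v ((x - y) * f ^ (q - 1)) = v (x - y) := by
    rw [hv.mul _ _ hxy (pow_ne_zero _ hfx0), hv.map_pow hfx0, hfx, mul_zero, add_zero]
  rw [e, ← hmain]
  refine hv.add_eq_of_lt hmain0 (hv.ge_mul (hv.ge_add hc (hy.mono hδ.le)) hfg) ?_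
  rw [hmain]
  linarith

/-- Distinct roots of `X^(q²) - a (c + X) f(X)^(q-1)` are equidistant. -/
theorem IsRatValuation.root_sub_root (hv : IsRatValuation v) {p n : ℕ} (hp : p.Prime)
    (hn : 1 ≤ n) (hvp : v (p : F) = 1) {a c x y : F} {w : ℚ} (ha0 : a ≠ 0)
    (hw0 : 0 < w) (hw1 : w < 1) (ha : v a = (((p ^ n * p ^ n : ℕ) : ℚ) - 1) * w)
    (hc : ValGe v 0 c)
    (hx : x ^ (p ^ n * p ^ n) =
      a * (c + x) * (1 + c * x ^ p ^ n + x ^ (p ^ n + 1)) ^ (p ^ n - 1))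
    (hy : y ^ (p ^ n * p ^ n) =
      a * (c + y) * (1 + c * y ^ p ^ n + y ^ (p ^ n + 1)) ^ (p ^ n - 1))
    (hxy : x ≠ y) :
    v (x - y) = w ∧ ∀ m, m ≤ n + n → v (x ^ p ^ m - y ^ p ^ m) = p ^ m * w := by
  have hq : 2 ≤ p ^ n := hp.two_le.trans (Nat.le_self_pow (by omega) p)
  have hS : (4 : ℚ) ≤ ((p ^ n * p ^ n : ℕ) : ℚ) := by
    exact_mod_cast Nat.mul_le_mul hq hq
  have hSp : p ^ n * p ^ n = p ^ (n + n) := (pow_add p n n).symm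
  have hva : 0 < v a := by
    rw [ha]
    exact mul_pos (by linarith) hw0
  have hδx := hv.root_ge (by omega) hva hc hx
  have hδy := hv.root_ge (by omega) hva hc hy
  have hδ : v a / ((p ^ n : ℕ) * (p ^ n : ℕ)) = w - w / ((p ^ n * p ^ n : ℕ) : ℚ) := by
    rw [ha, ← Nat.cast_mul]
    field_simp
  have hδ0 : 0 < v a / ((p ^ n : ℕ) * (p ^ n : ℕ)) := by positivity
  have hz0 : x - y ≠ 0 := sub_ne_zero.mpr hxy
  obtain ⟨hG0, hG⟩ := hv.map_cofactor_sub hq hδ0 hc hδx hδy hz0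
  rw [hδ] at hδy
  set S : ℕ := p ^ n * p ^ n with hSdef
  have hks : ∀ k : ℚ, k ≤ S → k * (w / S) ≤ w := by
    intro k hk
    calc k * (w / S) ≤ S * (w / S) := by gcongr
      _ = w := by field_simp
  have hmain : v (x - y) = w := by
    obtain ⟨t, ht⟩ : ∃ t, t = v (x - y) := ⟨_, rfl⟩
    have hE : ValGe v ((S - 1) * min t w + t + (1 - w)) (x ^ S - y ^ S - (x - y) ^ S) := by
      have := hv.ge_add_pow_prime_pow hp hvp (r := w - w / S) (s := t) hδy (Or.inr ht.le)
        (n + n) (b := (S - 1) * min t w + t + (1 - w)) ?_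
      · rwa [add_sub_cancel, ← hSp] at this
      · intro k hk
        rw [← hSp] at hk ⊢
        obtain ⟨hk0, hkS⟩ := Finset.mem_Ioo.mp hk
        have h1 : (k : ℚ) + 1 ≤ S := by exact_mod_cast hkS
        have h2 := hks k (by linarith)
        have h3 := mul_nonneg (Nat.cast_nonneg (α := ℚ) k) (sub_nonneg.mpr (min_le_right t w))
        have h4 := mul_nonneg (sub_nonneg.mpr h1) (sub_nonneg.mpr (min_le_left t w))
        linarith
    have hpz : v ((x - y) ^ S) = S * t := by rw [hv.map_pow hz0, ht]
    have hz0' := pow_ne_zero S hz0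
    have e : x ^ S - y ^ S = a * ((c + x) * (1 + c * x ^ p ^ n + x ^ (p ^ n + 1)) ^ (p ^ n - 1) -
        (c + y) * (1 + c * y ^ p ^ n + y ^ (p ^ n + 1)) ^ (p ^ n - 1)) := by
      rw [hx, hy]
      ring
    have hd0 : x ^ S - y ^ S ≠ 0 := e ▸ mul_ne_zero ha0 hG0
    have hd : v (x ^ S - y ^ S) = (S - 1) * w + t := by
      rw [e, hv.mul _ _ ha0 hG0, hG, ha, ht]
    rw [← ht]
    rcases lt_trichotomy t w with h | h | h
    · rw [min_eq_left h.le] at hE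
      have := (hv.add_eq_of_lt hz0' hE (by rw [hpz]; linarith)).2
      rw [add_sub_cancel, hd, hpz] at this
      nlinarith
    · exact h
    · rw [min_eq_right h.le] at hE
      have := (hv.add_eq_of_lt hd0 (hv.ge_neg hE) (by rw [hd]; linarith)).2
      rw [neg_sub, add_sub_cancel, hd, hpz] at this
      nlinarith
  refine ⟨hmain, fun m hm => ?_⟩
  have hmS : ((p ^ m : ℕ) : ℚ) ≤ S := by
    rw [hSp]
    exact_mod_cast Nat.pow_le_pow_right hp.pos hm
  have hE : ValGe v ((p ^ m : ℕ) * w + (1 - w)) (x ^ p ^ m - y ^ p ^ m - (x - y) ^ p ^ m) := by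
    have := hv.ge_add_pow_prime_pow hp hvp (r := w - w / S) (s := w) hδy (Or.inr hmain.ge)
      m (b := (p ^ m : ℕ) * w + (1 - w)) ?_
    · rwa [add_sub_cancel] at this
    · intro k hk
      have h1 : (k : ℚ) ≤ (p ^ m : ℕ) := by exact_mod_cast (Finset.mem_Ioo.mp hk).2.le
      have h2 := hks k (by linarith)
      linarith
  have hpz : v ((x - y) ^ p ^ m) = (p ^ m : ℕ) * w := by rw [hv.map_pow hz0, hmain]
  have := (hv.add_eq_of_lt (pow_ne_zero _ hz0) hE (by rw [hpz]; linarith)).2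
  rw [add_sub_cancel, hpz] at this
  exact_mod_cast this

theorem IsRatValuation.map_aCoef (hv : IsRatValuation v) {p n : ℕ} (hp0 : (p : F) ≠ 0)
    (hvp : v (p : F) = 1) :
    aCoef F p n ≠ 0 ∧ v (aCoef F p n) = ∑ i ∈ Finset.range n, (p : ℚ) ^ (i + 1) := by
  have h1 : (-1 : F) ≠ 0 := by simp
  have h2 : -(p : F) ≠ 0 := neg_ne_zero.mpr hp0
  refine ⟨mul_ne_zero (pow_ne_zero _ h1) (pow_ne_zero _ h2), ?_⟩
  rw [aCoef, hv.mul _ _ (pow_ne_zero _ h1) (pow_ne_zero _ h2), hv.map_pow h1, hv.map_pow h2,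
    hv.map_neg hp0, hv.map_neg_one, hvp]
  push_cast
  ring

theorem aeval_Lpoly {K : Type} [Field K] [Algebra K F] (p n : ℕ) (c : K) (y : F) :
    aeval y (Lpoly K p n c) = y ^ (p ^ n * p ^ n) - aCoef F p n * (algebraMap K F c + y) *
      (1 + algebraMap K F c * y ^ p ^ n + y ^ (p ^ n + 1)) ^ (p ^ n - 1) := by
  simp [Lpoly, fqc, aCoef]

end MonodromyRoots

set_option maxHeartbeats 1000000

/-- for `c ∈ O_K` with `v(c^p − c) ≥ 1` and `v(c) < p/((q+1)(p−1))`, any two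
distinct roots `y ≠ y′` of `L_c` satisfy
`v(y^(q²/p) − y′^(q²/p)) = (q²/p)·v(y − y′) = q²/((q+1)(p−1))`. -/
theorem stmt_11 (p n : ℕ) [Fact p.Prime] (hn : 1 ≤ n)
    (v : Omg p → ℚ)
    (hv_mul : ∀ x y : Omg p, x ≠ 0 → y ≠ 0 → v (x * y) = v x + v y)
    (hv_add : ∀ x y : Omg p, x ≠ 0 → y ≠ 0 → x + y ≠ 0 → min (v x) (v y) ≤ v (x + y))
    (hv_p : v ((p : ℕ) : Omg p) = 1)
    (hv_W : ∀ x : WittVector p (AlgebraicClosure (ZMod p)), x ≠ 0 →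
      0 ≤ v (algebraMap (Kzero p) (Omg p)
        (algebraMap (WittVector p (AlgebraicClosure (ZMod p))) (Kzero p) x)))
    (ζ : Omg p) (hζ : IsPrimitiveRoot ζ p)
    (μ : Omg p) (hμ : μ ^ (p ^ n + 1) = ζ - 1)
    (c : ↥(IntermediateField.adjoin (Kzero p) {μ}))
    (hc0 : (c : Omg p) ≠ 0) (hc_nonneg : 0 ≤ v (c : Omg p))
    (hcp : (c : Omg p) ^ p - (c : Omg p) = 0 ∨ 1 ≤ v ((c : Omg p) ^ p - (c : Omg p)))
    (hc_lt : v (c : Omg p) < (p : ℚ) / (((p : ℚ) ^ n + 1) * ((p : ℚ) - 1))) :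
    ∀ y y' : Omg p,
      Polynomial.aeval y (Lpoly ↥(IntermediateField.adjoin (Kzero p) {μ}) p n c) = 0 →
      Polynomial.aeval y' (Lpoly ↥(IntermediateField.adjoin (Kzero p) {μ}) p n c) = 0 →
      y ≠ y' →
      v (y ^ p ^ (2 * n - 1) - y' ^ p ^ (2 * n - 1)) = ((p : ℚ) ^ (2 * n) / (p : ℚ)) * v (y - y') ∧
      v (y ^ p ^ (2 * n - 1) - y' ^ p ^ (2 * n - 1)) =
        (p : ℚ) ^ (2 * n) / (((p : ℚ) ^ n + 1) * ((p : ℚ) - 1)) := by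
  have hp : p.Prime := Fact.out
  have hv : IsRatValuation v := ⟨hv_mul, hv_add⟩
  have hp0 : ((p : ℕ) : Omg p) ≠ 0 := hζ.neZero'.ne
  intro y y' hy hy' hne
  obtain ⟨ha0, ha⟩ := hv.map_aCoef (n := n) hp0 hv_p
  rw [aeval_Lpoly, sub_eq_zero] at hy hy'
  have hp2 : (2 : ℚ) ≤ p := by exact_mod_cast hp.two_le
  have hq2 : (2 : ℚ) ≤ (p : ℚ) ^ n := hp2.trans (le_self_pow₀ (by linarith) (by omega))
  have hp1 : (0 : ℚ) < (p : ℚ) - 1 := by linarith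
  have hden : 0 < ((p : ℚ) ^ n + 1) * ((p : ℚ) - 1) := by positivity
  have hw1 : (p : ℚ) / (((p : ℚ) ^ n + 1) * ((p : ℚ) - 1)) < 1 := by
    rw [div_lt_one hden]
    nlinarith
  have hsum : ∑ i ∈ Finset.range n, (p : ℚ) ^ (i + 1) =
      (((p ^ n * p ^ n : ℕ) : ℚ) - 1) * (p / (((p : ℚ) ^ n + 1) * ((p : ℚ) - 1))) := by
    simp_rw [pow_succ]
    rw [← Finset.sum_mul, geom_sum_eq (by linarith)]
    push_cast
    field_simp
    ring
  obtain ⟨h1, h2⟩ := hv.root_sub_root hp hn hv_p ha0 (by positivity) hw1 (ha.trans hsum)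
    (Or.inr hc_nonneg) hy hy' hne
  have h3 : (p : ℚ) ^ (2 * n) = (p : ℚ) ^ (2 * n - 1) * p := by
    rw [← pow_succ, Nat.sub_add_cancel (by omega)]
  rw [h2 (2 * n - 1) (by omega), h1, h3]
  constructor <;> field_simp
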